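/- Fix ι ∈ {0,1} and let π* ∈ Π_ι be level-optimal maximin. Then π* is universally closest for the one-sided refinement problem: for every divergence D satisfying channel-DPI, D(ν_ῑ^{(π*)}‖ν_ῑ) = inf{D(ν_ῑ^{(π)}‖ν_ῑ) : π ∈ Π_ι}. -/

import Mathlib

/- STATEMENT 10: Universal closestness of level-optimal maximin refinements
(Corollary `level_opt_maximin_universal_closest_one_sided`).  The side `ι ∈ {0,1}` is formalized
abstractly: `X` plays the role of `Ω_ι` and `Y` of `Ω_ῑ`. -/

open MeasureTheory ProbabilityTheory Filter
open scoped ENNReal NNReal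

noncomputable section

structure Divergence : Type 1 where
  D : (Ω : Type) → [MeasurableSpace Ω] → Measure Ω → Measure Ω → EReal

/-- Channel data-processing inequality. -/
def Divergence.HasDPI (𝒟 : Divergence) : Prop :=
  ∀ (Ω Ω' : Type) [MeasurableSpace Ω] [MeasurableSpace Ω']
    (K : Kernel Ω Ω') [IsMarkovKernel K]
    (P Q : Measure Ω) [IsFiniteMeasure P] [IsFiniteMeasure Q],
    𝒟.D Ω' (P.bind K) (Q.bind K) ≤ 𝒟.D Ω P Q

variable {X Y : Type} [MeasurableSpace X] [MeasurableSpace Y]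

/-- Refinements of `νX` on side `X`. -/
def Plans (E : Set (X × Y)) (νX : Measure X) : Set (Measure (X × Y)) :=
  {π | IsFiniteMeasure π ∧ π Eᶜ = 0 ∧ π.map Prod.fst = νX}

/-- Capped feasible subplans at level `t`. -/
def Feas (E : Set (X × Y)) (νX : Measure X) (νY : Measure Y) (t : ℝ) :
    Set (Measure (X × Y)) :=
  {σ | IsFiniteMeasure σ ∧ σ Eᶜ = 0 ∧ σ.map Prod.fst ≤ νX ∧
    σ.map Prod.snd ≤ (ENNReal.ofReal t) • νY}

/-- Maximal feasible mass at level `t`. -/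
def Fit (E : Set (X × Y)) (νX : Measure X) (νY : Measure Y) (t : ℝ) : ℝ≥0∞ :=
  ⨆ σ ∈ Feas E νX νY t, σ Set.univ

/-- Level-optimal maximin. -/
def LevelOptMaximin (E : Set (X × Y)) (νX : Measure X) (νY : Measure Y)
    (π : Measure (X × Y)) : Prop :=
  ∀ t : ℝ, 0 < t →
    ∫⁻ y, min ((π.map Prod.snd).rnDeriv νY y) (ENNReal.ofReal t) ∂νY = Fit E νX νY t

theorem exists_unitInterval_density {Y : Type*} [MeasurableSpace Y] (P Q : Measure Y)
    [IsFiniteMeasure P] [IsFiniteMeasure Q] :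
    ∃ h : Y → unitInterval, Measurable h ∧
      (P + Q).withDensity (fun y ↦ ENNReal.ofReal (h y)) = P ∧
      (P + Q).withDensity (fun y ↦ ENNReal.ofReal (1 - h y)) = Q := by
  have hP : P ≪ P + Q := Measure.absolutelyContinuous_of_le (Measure.le_add_right le_rfl)
  have hQ : Q ≪ P + Q := Measure.absolutelyContinuous_of_le (Measure.le_add_left le_rfl)
  have hsum : ∀ᵐ y ∂(P + Q), P.rnDeriv (P + Q) y + Q.rnDeriv (P + Q) y = 1 := by
    filter_upwards [Measure.rnDeriv_add' P Q (P + Q), Measure.rnDeriv_self (P + Q)] with y h1 h2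
    rw [← h2, h1, Pi.add_apply]
  refine ⟨fun y ↦ Set.projIcc 0 1 zero_le_one (P.rnDeriv (P + Q) y).toReal,
    continuous_projIcc.measurable.comp (Measure.measurable_rnDeriv _ _).ennreal_toReal, ?_, ?_⟩
  · conv_rhs => rw [← Measure.withDensity_rnDeriv_eq P _ hP]
    refine withDensity_congr_ae ?_
    filter_upwards [hsum] with y hy
    have h1 : P.rnDeriv (P + Q) y ≤ 1 := hy ▸ le_self_add
    have ht : P.rnDeriv (P + Q) y ≠ ∞ := ne_top_of_le_ne_top ENNReal.one_ne_top h1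
    rw [Set.projIcc_of_mem zero_le_one
      ⟨ENNReal.toReal_nonneg, ENNReal.toReal_le_of_le_ofReal zero_le_one (by simpa using h1)⟩]
    exact ENNReal.ofReal_toReal ht
  · conv_rhs => rw [← Measure.withDensity_rnDeriv_eq Q _ hQ]
    refine withDensity_congr_ae ?_
    filter_upwards [hsum] with y hy
    have h1 : P.rnDeriv (P + Q) y ≤ 1 := hy ▸ le_self_add
    have ht : P.rnDeriv (P + Q) y ≠ ∞ := ne_top_of_le_ne_top ENNReal.one_ne_top h1
    rw [Set.projIcc_of_mem zero_le_one
      ⟨ENNReal.toReal_nonneg, ENNReal.toReal_le_of_le_ofReal zero_le_one (by simpa using h1)⟩]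
    rw [ENNReal.ofReal_sub _ ENNReal.toReal_nonneg, ENNReal.ofReal_toReal ht, ENNReal.ofReal_one,
      ← hy, ENNReal.add_sub_cancel_left ht]

theorem map_withDensity_comp {A B : Type*} [MeasurableSpace A] [MeasurableSpace B]
    (μ : Measure A) {h : A → B} (hh : Measurable h) {f : B → ℝ≥0∞} (hf : Measurable f) :
    (μ.withDensity (fun a ↦ f (h a))).map h = (μ.map h).withDensity f := by
  ext s hs
  rw [Measure.map_apply hh hs, withDensity_apply _ (hh hs), withDensity_apply _ hs,
    setLIntegral_map hs hf hh]

theorem withDensity_fst_bind_condKernel {A B : Type*} [MeasurableSpace A] [MeasurableSpace B]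
    [StandardBorelSpace B] [Nonempty B] (ρ : Measure (A × B)) [IsFiniteMeasure ρ]
    {f : A → ℝ≥0∞} (hf : Measurable f) :
    (ρ.fst.withDensity f).bind ρ.condKernel = (ρ.withDensity (fun p ↦ f p.1)).snd := by
  ext s hs
  rw [Measure.bind_apply hs ρ.condKernel.aemeasurable,
    lintegral_withDensity_eq_lintegral_mul _ hf (ρ.condKernel.measurable_coe hs),
    Measure.snd_apply hs, withDensity_apply _ (measurable_snd hs)]
  conv_rhs => rw [← ρ.disintegrate ρ.condKernel]
  rw [← lintegral_indicator (measurable_snd hs), Measure.lintegral_compProd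
    (show Measurable ((Prod.snd ⁻¹' s).indicator fun p : A × B ↦ f p.1) from
      (hf.comp measurable_fst).indicator (measurable_snd hs))]
  refine lintegral_congr fun a ↦ ?_
  have : ∀ b, (Prod.snd ⁻¹' s).indicator (fun p : A × B ↦ f p.1) (a, b)
      = s.indicator (fun _ ↦ f a) b := fun b ↦ rfl
  simp [this, lintegral_indicator hs]

/-- A finite measure together with a measurable statistic can be resampled from the statistic. -/
theorem exists_kernel_recovering {A B : Type} [MeasurableSpace A] [MeasurableSpace B]
    [StandardBorelSpace A] [Nonempty A] (μ : Measure A) [IsFiniteMeasure μ]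
    {h : A → B} (hh : Measurable h) :
    ∃ L : Kernel B A, IsMarkovKernel L ∧ ∀ f : B → ℝ≥0∞, Measurable f →
      ((μ.withDensity fun a ↦ f (h a)).map h).bind L = μ.withDensity fun a ↦ f (h a) := by
  have hm : Measurable fun a ↦ (h a, a) := hh.prodMk measurable_id
  refine ⟨(μ.map fun a ↦ (h a, a)).condKernel, inferInstance, fun f hf ↦ ?_⟩
  have h1 : (μ.map fun a ↦ (h a, a)).fst = μ.map h := Measure.fst_map_prodMk measurable_id
  rw [map_withDensity_comp μ hh hf, ← h1, withDensity_fst_bind_condKernel _ hf,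
    ← map_withDensity_comp μ hm (f := fun p ↦ f p.1) (hf.comp measurable_fst),
    Measure.snd_map_prodMk hh]
  exact Measure.map_id

/-- Left-anchored piecewise linear interpolation of `φ` at the points `k / n`. -/
def hingeInterpolation (φ : ℝ → ℝ) (n : ℕ) (m : ℕ) (v : ℝ) : ℝ :=
  φ 0 + n * (φ (1 / n) - φ 0) * v + ∑ k ∈ Finset.range m,
    n * (φ ((k + 2) / n) - 2 * φ ((k + 1) / n) + φ (k / n)) * max 0 (v - (k + 1) / n)

theorem hingeInterpolation_of_le (φ : ℝ → ℝ) {n : ℕ} (hn : 0 < n) (m : ℕ) {v : ℝ}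
    (hv : m / n ≤ v) :
    hingeInterpolation φ n m v
      = φ (m / n) + n * (φ ((m + 1) / n) - φ (m / n)) * (v - m / n) := by
  have hn' : (0 : ℝ) < n := by exact_mod_cast hn
  induction m with
  | zero => simp [hingeInterpolation]
  | succ m ih =>
    have hlt : (m : ℝ) / n ≤ v := by
      refine le_trans ?_ hv
      push_cast
      gcongr
      linarith
    have ih := ih hlt
    rw [hingeInterpolation] at ih ⊢
    rw [Finset.sum_range_succ, ← add_assoc, ih, max_eq_right (by push_cast at hv; linarith)]
    push_cast
    rw [add_assoc (m : ℝ) 1 1, one_add_one_eq_two]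
    field_simp
    ring

theorem hingeInterpolation_eq_of_le (φ : ℝ → ℝ) (n : ℕ) {m M : ℕ} (hM : m ≤ M) {v : ℝ}
    (hv : v ≤ (m + 1) / n) : hingeInterpolation φ n M v = hingeInterpolation φ n m v := by
  rw [hingeInterpolation, hingeInterpolation, ← Finset.sum_range_add_sum_Ico _ hM,
    ← add_assoc, add_eq_left]
  refine Finset.sum_eq_zero fun k hk ↦ ?_
  have hmk : (m : ℝ) ≤ k := by exact_mod_cast (Finset.mem_Ico.1 hk).1
  have : ((m : ℝ) + 1) / n ≤ (k + 1) / n := by gcongr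
  rw [max_eq_left (by linarith), mul_zero]

theorem abs_hingeInterpolation_sub_le {φ : ℝ → ℝ} {B : ℝ}
    (hφ : ∀ x y, |φ x - φ y| ≤ B * |x - y|) {n : ℕ} (hn : 0 < n) {v : ℝ}
    (hv0 : 0 ≤ v) (hv1 : v ≤ 1) :
    |hingeInterpolation φ n (n - 1) v - φ v| ≤ 2 * B / n := by
  have hn' : (0 : ℝ) < n := by exact_mod_cast hn
  have hB : 0 ≤ B := by simpa using (abs_nonneg _).trans (hφ 1 0)
  obtain ⟨m, hm, hmv, hvm⟩ : ∃ m : ℕ, m ≤ n - 1 ∧ (m : ℝ) / n ≤ v ∧ v ≤ (m + 1) / n := by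
    rcases hv1.eq_or_lt with rfl | hlt
    · refine ⟨n - 1, le_rfl, ?_, ?_⟩
      · rw [div_le_one hn']; exact_mod_cast Nat.sub_le n 1
      · rw [le_div_iff₀ hn']; push_cast [Nat.cast_sub (Nat.succ_le_of_lt hn)]; simp
    · refine ⟨⌊n * v⌋₊, ?_, ?_, ?_⟩
      · have : ⌊n * v⌋₊ < n := (Nat.floor_lt (by positivity)).2 (by nlinarith)
        omega
      · rw [div_le_iff₀ hn', mul_comm]; exact Nat.floor_le (by positivity)
      · rw [le_div_iff₀ hn', mul_comm]; exact (Nat.lt_floor_add_one _).le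
  rw [hingeInterpolation_eq_of_le φ n hm hvm, hingeInterpolation_of_le φ hn m hmv]
  have hd : ((m : ℝ) + 1) / n - m / n = 1 / n := by ring
  have h1 : |φ (m / n) - φ v| ≤ B / n := by
    refine (hφ _ _).trans ?_
    rw [abs_sub_comm, abs_of_nonneg (by linarith), div_eq_mul_one_div B]
    exact mul_le_mul_of_nonneg_left (by linarith) hB
  have h2 : |φ ((m + 1) / n) - φ (m / n)| ≤ B / n := by
    refine (hφ _ _).trans ?_
    rw [hd, abs_of_pos (by positivity), div_eq_mul_one_div B]
  have h3 : |n * (φ ((m + 1) / n) - φ (m / n)) * (v - m / n)| ≤ B / n := by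
    have h0 : n * (v - m / n) ≤ 1 := by
      have : v - m / n ≤ 1 / n := by linarith
      rwa [le_div_iff₀' hn'] at this
    have h0' : 0 ≤ n * (v - m / n) := mul_nonneg hn'.le (by linarith)
    rw [mul_right_comm, abs_mul, abs_of_nonneg h0']
    calc _ ≤ 1 * (B / n) := by gcongr
      _ = _ := one_mul _
  calc _ = |(φ (m / n) - φ v) + n * (φ ((m + 1) / n) - φ (m / n)) * (v - m / n)| := by ring_nf
    _ ≤ _ := abs_add_le _ _
    _ ≤ B / n + B / n := add_le_add h1 h3
    _ = _ := by ring

theorem continuous_hingeInterpolation (φ : ℝ → ℝ) (n m : ℕ) :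
    Continuous (hingeInterpolation φ n m) := by
  unfold hingeInterpolation
  fun_prop

theorem integrable_of_continuous_unitInterval (μ : Measure unitInterval) [IsFiniteMeasure μ]
    {f : unitInterval → ℝ} (hf : Continuous f) : Integrable f μ :=
  hf.integrable_of_hasCompactSupport (HasCompactSupport.of_compactSpace f)

/-- Domination in the convex order, tested on hinges, implies domination on Lipschitz midpoint
convex functions. -/
theorem integral_convex_le_of_hinge_le {α β : Measure unitInterval} [IsFiniteMeasure α]
    [IsFiniteMeasure β] (hmass : β.real Set.univ = α.real Set.univ)
    (hmean : ∫ v, (v : ℝ) ∂β = ∫ v, (v : ℝ) ∂α)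
    (hhinge : ∀ c : ℝ, 0 < c → c < 1 →
      ∫ v, max 0 ((v : ℝ) - c) ∂β ≤ ∫ v, max 0 ((v : ℝ) - c) ∂α)
    {φ : ℝ → ℝ} {B : ℝ} (hφ : ∀ x y, |φ x - φ y| ≤ B * |x - y|)
    (hconv : ∀ x d, 2 * φ x ≤ φ (x + d) + φ (x - d)) :
    ∫ v, φ (v : ℝ) ∂β ≤ ∫ v, φ (v : ℝ) ∂α := by
  have hB : 0 ≤ B := by simpa using (abs_nonneg _).trans (hφ 1 0)
  have hcont : Continuous φ := (LipschitzWith.of_dist_le_mul (K := B.toNNReal) fun x y ↦ by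
    simpa [Real.dist_eq, hB] using hφ x y).continuous
  have hint (μ : Measure unitInterval) [IsFiniteMeasure μ] :
      Integrable (fun v : unitInterval ↦ φ v) μ :=
    integrable_of_continuous_unitInterval μ (by fun_prop)
  have hintG (μ : Measure unitInterval) [IsFiniteMeasure μ] (n m : ℕ) :
      Integrable (fun v : unitInterval ↦ hingeInterpolation φ n m v) μ :=
    integrable_of_continuous_unitInterval μ
      ((continuous_hingeInterpolation φ n m).comp continuous_subtype_val)
  have hG (n : ℕ) (hn : 0 < n) (m : ℕ) (hm : m ≤ n - 1) :
      ∫ v, hingeInterpolation φ n m (v : ℝ) ∂β ≤ ∫ v, hingeInterpolation φ n m (v : ℝ) ∂α := by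
    have hn' : (0 : ℝ) < n := by exact_mod_cast hn
    induction m with
    | zero =>
      have key (μ : Measure unitInterval) [IsFiniteMeasure μ] :
          ∫ v, hingeInterpolation φ n 0 (v : ℝ) ∂μ
            = μ.real Set.univ * φ 0 + n * (φ (1 / n) - φ 0) * ∫ v, (v : ℝ) ∂μ := by
        simp only [hingeInterpolation, Finset.range_zero, Finset.sum_empty, add_zero]
        rw [integral_add (integrable_const _)
          (integrable_of_continuous_unitInterval μ (by fun_prop)), integral_const_mul]
        simp
      rw [key, key, hmass, hmean]
    | succ m ih =>
      have key (μ : Measure unitInterval) [IsFiniteMeasure μ] :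
          ∫ v, hingeInterpolation φ n (m + 1) (v : ℝ) ∂μ
            = ∫ v, hingeInterpolation φ n m (v : ℝ) ∂μ
              + n * (φ ((m + 2) / n) - 2 * φ ((m + 1) / n) + φ (m / n))
                * ∫ v, max 0 ((v : ℝ) - (m + 1) / n) ∂μ := by
        rw [← integral_const_mul, ← integral_add (hintG μ n m)
          (integrable_of_continuous_unitInterval μ (by fun_prop))]
        simp only [hingeInterpolation, Finset.sum_range_succ, add_assoc]
      rw [key, key]
      refine add_le_add (ih (by omega)) (mul_le_mul_of_nonneg_left (hhinge _ (by positivity) ?_) ?_)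
      · rw [div_lt_one hn']
        exact_mod_cast (by omega : m + 1 < n)
      · have h := hconv ((m + 1) / n) (1 / n)
        have e1 : ((m : ℝ) + 1) / n + 1 / n = (m + 2) / n := by ring
        have e2 : ((m : ℝ) + 1) / n - 1 / n = m / n := by ring
        rw [e1, e2] at h
        exact mul_nonneg hn'.le (by linarith)
  have hclose (μ : Measure unitInterval) [IsFiniteMeasure μ] (n : ℕ) (hn : 0 < n) :
      |∫ v, hingeInterpolation φ n (n - 1) (v : ℝ) ∂μ - ∫ v, φ (v : ℝ) ∂μ|
        ≤ 2 * B / n * μ.real Set.univ := by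
    rw [← integral_sub (hintG μ _ _) (hint μ)]
    have hbound (v : unitInterval) :
        ‖hingeInterpolation φ n (n - 1) v - φ v‖ ≤ 2 * B / n :=
      abs_hingeInterpolation_sub_le hφ hn v.2.1 v.2.2
    exact norm_integral_le_of_norm_le_const (.of_forall hbound)
  have hlim : Tendsto (fun n : ℕ ↦ ∫ v, φ (v : ℝ) ∂α
      + 2 * (2 * B * α.real Set.univ) / n) atTop (nhds (∫ v, φ (v : ℝ) ∂α)) := by
    simpa using (tendsto_const_div_atTop_nhds_zero_nat
      (2 * (2 * B * α.real Set.univ))).const_add (∫ v, φ (v : ℝ) ∂α)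
  refine ge_of_tendsto hlim ?_
  filter_upwards [eventually_gt_atTop 0] with n hn
  have h1 := abs_le.1 (hclose α n hn)
  have h2 := abs_le.1 (hclose β n hn)
  have h3 := hG n hn (n - 1) le_rfl
  rw [hmass] at h2
  have : 2 * (2 * B * α.real Set.univ) / n = 2 * (2 * B / n * α.real Set.univ) := by ring
  linarith [h1.1, h1.2, h2.1, h2.2]

theorem integral_le_of_forall_affine_le {α β : Measure unitInterval} [IsFiniteMeasure α]
    [IsFiniteMeasure β] (hmass : β.real Set.univ = α.real Set.univ)
    (hmean : ∫ v, (v : ℝ) ∂β = ∫ v, (v : ℝ) ∂α)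
    (hhinge : ∀ c : ℝ, 0 < c → c < 1 →
      ∫ v, max 0 ((v : ℝ) - c) ∂β ≤ ∫ v, max 0 ((v : ℝ) - c) ∂α)
    (f a b : C(unitInterval, ℝ))
    (h : ∀ u v : unitInterval, a u + b u * ((v : ℝ) - u) ≤ f v) :
    ∫ u, a u ∂β ≤ ∫ v, f v ∂α := by
  let φ : ℝ → ℝ := fun x ↦ ⨆ u : unitInterval, (a u + b u * (x - u))
  have hbdd (x : ℝ) : BddAbove (Set.range fun u : unitInterval ↦ a u + b u * (x - u)) :=
    (isCompact_range (by fun_prop)).bddAbove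
  have hle (x : ℝ) (u : unitInterval) : a u + b u * (x - u) ≤ φ x := le_ciSup (hbdd x) u
  have hb (u : unitInterval) : |b u| ≤ ‖b‖ := b.norm_coe_le_norm u
  have hlip' (x y : ℝ) : φ x ≤ φ y + ‖b‖ * |x - y| := by
    refine ciSup_le fun u ↦ ?_
    have h1 : b u * (x - y) ≤ ‖b‖ * |x - y| :=
      (le_abs_self _).trans ((abs_mul _ _).trans_le (by gcongr; exact hb u))
    linarith [hle y u]
  have hlip (x y : ℝ) : |φ x - φ y| ≤ ‖b‖ * |x - y| := by
    rw [abs_sub_le_iff]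
    exact ⟨by linarith [hlip' x y], by rw [abs_sub_comm]; linarith [hlip' y x]⟩
  have hconv (x d : ℝ) : 2 * φ x ≤ φ (x + d) + φ (x - d) := by
    have : φ x ≤ (φ (x + d) + φ (x - d)) / 2 :=
      ciSup_le fun u ↦ by linarith [hle (x + d) u, hle (x - d) u]
    linarith
  have hcont : Continuous φ := (LipschitzWith.of_dist_le_mul (K := ‖b‖₊) fun x y ↦ by
    simpa [Real.dist_eq] using hlip x y).continuous
  have hint (μ : Measure unitInterval) [IsFiniteMeasure μ] :
      Integrable (fun v : unitInterval ↦ φ v) μ :=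
    integrable_of_continuous_unitInterval μ (by fun_prop)
  calc ∫ u, a u ∂β ≤ ∫ u : unitInterval, φ u ∂β :=
        integral_mono (integrable_of_continuous_unitInterval β a.continuous) (hint β)
          fun u ↦ by simpa using hle u u
    _ ≤ ∫ v : unitInterval, φ v ∂α := integral_convex_le_of_hinge_le hmass hmean hhinge hlip hconv
    _ ≤ ∫ v, f v ∂α := integral_mono (hint α)
        (integrable_of_continuous_unitInterval α f.continuous) fun v ↦ ciSup_le fun u ↦ h u v

/-- The cone of continuous functions on the square whose section at each `u` dominates an affine
function `v ↦ a u + b u * (v - u)`, where `a`, `b` are continuous and `∫ a ∂β ≥ 0`. -/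
def affineMinorantCone (β : Measure unitInterval) [IsFiniteMeasure β] :
    PointedCone ℝ C(unitInterval × unitInterval, ℝ) where
  carrier := {F | ∃ a b : C(unitInterval, ℝ), 0 ≤ ∫ u, a u ∂β ∧
    ∀ v u : unitInterval, a u + b u * ((v : ℝ) - u) ≤ F (v, u)}
  add_mem' := by
    rintro F G ⟨a, b, hab, hF⟩ ⟨a', b', hab', hG⟩
    refine ⟨a + a', b + b', ?_, fun v u ↦ ?_⟩
    · simp only [ContinuousMap.add_apply]
      rw [integral_add (integrable_of_continuous_unitInterval β a.continuous)
        (integrable_of_continuous_unitInterval β a'.continuous)]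
      exact add_nonneg hab hab'
    · simp only [ContinuousMap.add_apply]
      linarith [hF v u, hG v u]
  zero_mem' := ⟨0, 0, by simp, by simp⟩
  smul_mem' := by
    rintro c F ⟨a, b, hab, hF⟩
    refine ⟨c.1 • a, c.1 • b, ?_, fun v u ↦ ?_⟩
    · simp only [ContinuousMap.smul_apply, smul_eq_mul, integral_const_mul]
      exact mul_nonneg c.2 hab
    · have h := mul_le_mul_of_nonneg_left (hF v u) c.2
      change c.1 * a u + c.1 * b u * ((v : ℝ) - u) ≤ c.1 * F (v, u)
      linarith

theorem exists_measure_of_positive_functional {K : Type*} [TopologicalSpace K] [CompactSpace K]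
    [T2Space K] [MeasurableSpace K] [BorelSpace K] (g : C(K, ℝ) →ₗ[ℝ] ℝ)
    (hg : ∀ f : C(K, ℝ), 0 ≤ f → 0 ≤ g f) :
    ∃ Γ : Measure K, IsFiniteMeasure Γ ∧ ∀ f : C(K, ℝ), ∫ x, f x ∂Γ = g f := by
  let g' : CompactlySupportedContinuousMap K ℝ →ₗ[ℝ] ℝ :=
    { toFun := fun f ↦ g f
      map_add' := fun f f' ↦ g.map_add (f : C(K, ℝ)) f'
      map_smul' := fun c f ↦ g.map_smul c (f : C(K, ℝ)) }
  let Λ : CompactlySupportedContinuousMap K ℝ →ₚ[ℝ] ℝ :=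
    PositiveLinearMap.mk₀ g' fun f hf ↦ hg (f : C(K, ℝ)) hf
  refine ⟨RealRMK.rieszMeasure Λ, inferInstance, fun f ↦ ?_⟩
  exact RealRMK.integral_rieszMeasure Λ (CompactlySupportedContinuousMap.continuousMapEquiv f)

/-- One-dimensional Strassen theorem on the unit interval: the convex order, tested on hinges,
yields a martingale coupling. -/
theorem exists_martingale_coupling {α β : Measure unitInterval} [IsFiniteMeasure α]
    [IsFiniteMeasure β] (hpos : β.real Set.univ ≠ 0)
    (hmass : β.real Set.univ = α.real Set.univ)
    (hmean : ∫ v, (v : ℝ) ∂β = ∫ v, (v : ℝ) ∂α)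
    (hhinge : ∀ c : ℝ, 0 < c → c < 1 →
      ∫ v, max 0 ((v : ℝ) - c) ∂β ≤ ∫ v, max 0 ((v : ℝ) - c) ∂α) :
    ∃ Γ : Measure (unitInterval × unitInterval), IsFiniteMeasure Γ ∧
      (∀ f : C(unitInterval, ℝ), ∫ p, f p.1 ∂Γ = ∫ v, f v ∂α) ∧
      (∀ f : C(unitInterval, ℝ), ∫ p, f p.2 ∂Γ = ∫ u, f u ∂β) ∧
      ∀ f : C(unitInterval, ℝ), ∫ p, f p.2 * ((p.1 : ℝ) - p.2) ∂Γ = 0 := by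
  let T : C(unitInterval, ℝ) →ₗ[ℝ] C(unitInterval × unitInterval, ℝ) :=
    { toFun := fun f ↦ f.comp ⟨Prod.fst, continuous_fst⟩
      map_add' := fun _ _ ↦ rfl
      map_smul' := fun _ _ ↦ rfl }
  have hT : Function.Injective T := fun f f' h ↦ by
    ext v
    exact DFunLike.congr_fun h (v, 0)
  let ℓ : C(unitInterval, ℝ) →ₗ[ℝ] ℝ :=
    { toFun := fun f ↦ ∫ v, f v ∂α
      map_add' := fun f f' ↦ integral_add
        (integrable_of_continuous_unitInterval α f.continuous)
        (integrable_of_continuous_unitInterval α f'.continuous)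
      map_smul' := fun c f ↦ integral_const_mul c f }
  let e := LinearEquiv.ofInjective T hT
  obtain ⟨g, hgext, hgpos⟩ := riesz_extension (affineMinorantCone β)
    ⟨LinearMap.range T, ℓ ∘ₗ e.symm.toLinearMap⟩ (by
      rintro ⟨_, f, rfl⟩ ⟨a, b, hab, hF⟩
      have he : e.symm ⟨T f, f, rfl⟩ = f := e.symm_apply_apply f
      change 0 ≤ ℓ (e.symm ⟨T f, f, rfl⟩)
      rw [he]
      exact hab.trans (integral_le_of_forall_affine_le hmass hmean hhinge f a b
        fun u v ↦ hF v u))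
    (fun F ↦ ⟨⟨T (ContinuousMap.const _ ‖F‖), _, rfl⟩, 0, 0, by simp, fun v u ↦ by
      have := (abs_le.1 (F.norm_coe_le_norm (v, u))).1
      change (0 : ℝ) + 0 * _ ≤ ‖F‖ + F (v, u)
      linarith⟩)
  have hgT (f : C(unitInterval, ℝ)) : g (T f) = ∫ v, f v ∂α := by
    have he : e.symm ⟨T f, f, rfl⟩ = f := e.symm_apply_apply f
    have h := hgext ⟨T f, f, rfl⟩
    change g (T f) = ℓ (e.symm ⟨T f, f, rfl⟩) at h
    rwa [he] at h
  have hzero (F : C(unitInterval × unitInterval, ℝ)) (a b : C(unitInterval, ℝ))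
      (ha : ∫ u, a u ∂β = 0) (hF : ∀ v u : unitInterval, F (v, u) = a u + b u * ((v : ℝ) - u)) :
      g F = 0 := by
    refine le_antisymm ?_ (hgpos F ⟨a, b, ha.ge, fun v u ↦ (hF v u).ge⟩)
    have h : 0 ≤ g (-F) := hgpos (-F) ⟨-a, -b, by simp [integral_neg, ha], fun v u ↦ by
      simp only [ContinuousMap.neg_apply, hF]
      linarith⟩
    rw [map_neg] at h
    linarith
  obtain ⟨Γ, hΓ, hΓg⟩ := exists_measure_of_positive_functional g fun F hF ↦
    hgpos F ⟨0, 0, by simp, fun v u ↦ by simpa using hF (v, u)⟩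
  refine ⟨Γ, hΓ, fun f ↦ (hΓg (T f)).trans (hgT f), fun f ↦ ?_, fun f ↦ ?_⟩
  · let S : C(unitInterval × unitInterval, ℝ) := f.comp ⟨Prod.snd, continuous_snd⟩
    set m := (∫ u, f u ∂β) / β.real Set.univ with hm
    have h0 : g (S - T (ContinuousMap.const _ m)) = 0 := by
      refine hzero _ (f - ContinuousMap.const _ m) 0 ?_ fun v u ↦ ?_
      · simp only [ContinuousMap.sub_apply, ContinuousMap.const_apply]
        rw [integral_sub (integrable_of_continuous_unitInterval β f.continuous)
          (integrable_const _), integral_const, smul_eq_mul, hm, mul_div_cancel₀ _ hpos, sub_self]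
      · change f u - m = (f u - m) + 0 * _
        ring
    rw [map_sub, hgT, sub_eq_zero] at h0
    change ∫ p, S p ∂Γ = _
    rw [hΓg, h0]
    simp only [ContinuousMap.const_apply, integral_const, smul_eq_mul]
    rw [← hmass, hm, mul_div_cancel₀ _ hpos]
  · let S : C(unitInterval × unitInterval, ℝ) :=
      ⟨fun p ↦ f p.2 * ((p.1 : ℝ) - p.2), by fun_prop⟩
    change ∫ p, S p ∂Γ = 0
    rw [hΓg]
    exact hzero S 0 f (by simp) fun v u ↦ by simp [S]

theorem integral_withDensity_ofReal {A : Type*} [MeasurableSpace A] (μ : Measure A)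
    {w : A → ℝ} (hw : Measurable w) (hw0 : ∀ a, 0 ≤ w a) (f : A → ℝ) :
    ∫ a, f a ∂μ.withDensity (fun a ↦ ENNReal.ofReal (w a)) = ∫ a, w a * f a ∂μ := by
  rw [integral_withDensity_eq_integral_toReal_smul hw.ennreal_ofReal
    (.of_forall fun _ ↦ ENNReal.ofReal_lt_top)]
  simp [ENNReal.toReal_ofReal, hw0]

/-- A martingale coupling of likelihood-ratio laws induces a Markov kernel transporting every
nonnegative affine density. -/
theorem exists_kernel_of_convexOrder {α β : Measure unitInterval} [IsFiniteMeasure α]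
    [IsFiniteMeasure β] (hpos : β.real Set.univ ≠ 0)
    (hmass : β.real Set.univ = α.real Set.univ)
    (hmean : ∫ v, (v : ℝ) ∂β = ∫ v, (v : ℝ) ∂α)
    (hhinge : ∀ c : ℝ, 0 < c → c < 1 →
      ∫ v, max 0 ((v : ℝ) - c) ∂β ≤ ∫ v, max 0 ((v : ℝ) - c) ∂α) :
    ∃ K : Kernel unitInterval unitInterval, IsMarkovKernel K ∧ ∀ p q : ℝ,
      (∀ v : unitInterval, 0 ≤ p + q * v) →
      (α.withDensity fun v ↦ ENNReal.ofReal (p + q * v)).bind K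
        = β.withDensity fun v ↦ ENNReal.ofReal (p + q * v) := by
  obtain ⟨Γ, hΓ, hfst, hsnd, hmart⟩ := exists_martingale_coupling hpos hmass hmean hhinge
  have hΓα : Γ.fst = α := by
    refine ext_of_forall_integral_eq_of_IsFiniteMeasure fun f ↦ ?_
    rw [Measure.fst, integral_map measurable_fst.aemeasurable
      f.continuous.measurable.aestronglyMeasurable]
    exact hfst f.toContinuousMap
  have hintΓ {f : unitInterval × unitInterval → ℝ} (hf : Continuous f) : Integrable f Γ :=
    hf.integrable_of_hasCompactSupport (HasCompactSupport.of_compactSpace f)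
  refine ⟨Γ.condKernel, inferInstance, fun p q hpq ↦ ?_⟩
  have hw : Measurable fun v : unitInterval ↦ p + q * (v : ℝ) := by fun_prop
  have hfin {A : Type} [TopologicalSpace A] [CompactSpace A] [MeasurableSpace A] [BorelSpace A]
      (μ : Measure A) [IsFiniteMeasure μ] {f : A → ℝ} (hf : Continuous f) :
      IsFiniteMeasure (μ.withDensity fun a ↦ ENNReal.ofReal (f a)) :=
    isFiniteMeasure_withDensity_ofReal
      (hf.integrable_of_hasCompactSupport (HasCompactSupport.of_compactSpace f)).2
  have := hfin Γ (f := fun x ↦ p + q * (x.1 : ℝ)) (by fun_prop)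
  have := hfin β (f := fun x ↦ p + q * (x : ℝ)) (by fun_prop)
  rw [← hΓα, withDensity_fst_bind_condKernel Γ hw.ennreal_ofReal]
  refine ext_of_forall_integral_eq_of_IsFiniteMeasure fun f ↦ ?_
  rw [Measure.snd, integral_map measurable_snd.aemeasurable
      f.continuous.measurable.aestronglyMeasurable,
    integral_withDensity_ofReal Γ (w := fun x ↦ p + q * (x.1 : ℝ)) (hw.comp measurable_fst)
      (fun x ↦ hpq x.1),
    integral_withDensity_ofReal β hw hpq]
  have h1 := hsnd ⟨fun u ↦ (p + q * u) * f u, by fun_prop⟩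
  have h2 := hmart ⟨fun u ↦ q * f u, by fun_prop⟩
  simp only [ContinuousMap.coe_mk] at h1 h2
  have h3 := integral_add (μ := Γ) (f := fun x ↦ (p + q * x.2) * f x.2)
    (g := fun x ↦ q * f x.2 * ((x.1 : ℝ) - x.2)) (hintΓ (by fun_prop)) (hintΓ (by fun_prop))
  rw [h2, add_zero, h1] at h3
  rw [← h3]
  exact integral_congr_ae (.of_forall fun x ↦ by ring)

/-- A comparison of truncated likelihood masses at all levels yields a Markov kernel between
likelihood-ratio laws. -/
theorem exists_kernel_of_lintegral_min_le {α β : Measure unitInterval} [IsFiniteMeasure α]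
    [IsFiniteMeasure β] (hpos : β Set.univ ≠ 0) (hmass : β Set.univ = α Set.univ)
    (hmean : ∫⁻ v, ENNReal.ofReal v ∂β = ∫⁻ v, ENNReal.ofReal v ∂α)
    (hmin : ∀ t : ℝ, 0 < t →
      ∫⁻ v, ENNReal.ofReal (min (v : ℝ) (t * (1 - v))) ∂α
        ≤ ∫⁻ v, ENNReal.ofReal (min (v : ℝ) (t * (1 - v))) ∂β) :
    ∃ K : Kernel unitInterval unitInterval, IsMarkovKernel K ∧ ∀ p q : ℝ,
      (∀ v : unitInterval, 0 ≤ p + q * v) →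
      (α.withDensity fun v ↦ ENNReal.ofReal (p + q * v)).bind K
        = β.withDensity fun v ↦ ENNReal.ofReal (p + q * v) := by
  have hint (μ : Measure unitInterval) [IsFiniteMeasure μ] {f : unitInterval → ℝ}
      (hf : Continuous f) : Integrable f μ := integrable_of_continuous_unitInterval μ hf
  have hmean' : ∫ v, (v : ℝ) ∂β = ∫ v, (v : ℝ) ∂α := by
    rw [integral_eq_lintegral_of_nonneg_ae (.of_forall fun v ↦ v.2.1)
        (hint β (by fun_prop)).1, hmean,
      integral_eq_lintegral_of_nonneg_ae (.of_forall fun v ↦ v.2.1) (hint α (by fun_prop)).1]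
  refine exists_kernel_of_convexOrder (ENNReal.toReal_ne_zero.2 ⟨hpos, measure_ne_top _ _⟩)
    (by simp [measureReal_def, hmass]) hmean' fun c hc0 hc1 ↦ ?_
  have hc : 0 < 1 - c := by linarith
  set t := c / (1 - c) with ht
  have ht0 : 0 < t := div_pos hc0 hc
  have hpt (v : unitInterval) :
      max 0 ((v : ℝ) - c) = (1 - c) * (v - min (v : ℝ) (t * (1 - v))) := by
    have h1 : (1 - c) * (t * (1 - v)) = c * (1 - v) := by
      rw [ht]; field_simp
    rw [mul_sub, mul_min_of_nonneg _ _ hc.le, h1, ← max_sub_sub_left]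
    congr 1 <;> ring
  have hmono : ∫ v, min (v : ℝ) (t * (1 - v)) ∂α ≤ ∫ v, min (v : ℝ) (t * (1 - v)) ∂β := by
    have h0 (v : unitInterval) : 0 ≤ min (v : ℝ) (t * (1 - v)) :=
      le_min v.2.1 (mul_nonneg ht0.le (sub_nonneg.2 v.2.2))
    have := hmin t ht0
    rwa [← ofReal_integral_eq_lintegral_ofReal (hint α (by fun_prop)) (.of_forall h0),
      ← ofReal_integral_eq_lintegral_ofReal (hint β (by fun_prop)) (.of_forall h0),
      ENNReal.ofReal_le_ofReal_iff (integral_nonneg h0)] at this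
  simp only [hpt]
  rw [integral_const_mul, integral_const_mul,
    integral_sub (hint β (by fun_prop)) (hint β (by fun_prop)),
    integral_sub (hint α (by fun_prop)) (hint α (by fun_prop)), hmean']
  exact mul_le_mul_of_nonneg_left (by linarith) hc.le

theorem lintegral_min_rnDeriv_le {Z : Type*} [MeasurableSpace Z] {P Q : Measure Z}
    [IsFiniteMeasure P] [IsFiniteMeasure Q] {h : Z → unitInterval} (hh : Measurable h)
    (hP : (P + Q).withDensity (fun y ↦ ENNReal.ofReal (h y)) = P)
    (hQ : (P + Q).withDensity (fun y ↦ ENNReal.ofReal (1 - h y)) = Q) {t : ℝ} (ht : 0 ≤ t) :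
    ∫⁻ y, min (P.rnDeriv Q y) (ENNReal.ofReal t) ∂Q
      ≤ ∫⁻ y, ENNReal.ofReal (min (h y : ℝ) (t * (1 - h y))) ∂(P + Q) := by
  have hh1 : Measurable fun y ↦ ENNReal.ofReal (1 - h y) := by fun_prop
  have hr : Measurable (P.rnDeriv Q) := Measure.measurable_rnDeriv P Q
  have hle : ∀ᵐ y ∂(P + Q), ENNReal.ofReal (1 - h y) * P.rnDeriv Q y ≤ ENNReal.ofReal (h y) := by
    refine ae_le_of_forall_setLIntegral_le_of_sigmaFinite (hh1.mul hr) fun s hs _ ↦ ?_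
    have h1 := Measure.withDensity_rnDeriv_le P Q s
    rw [withDensity_apply _ hs] at h1
    calc ∫⁻ y in s, ENNReal.ofReal (1 - h y) * P.rnDeriv Q y ∂(P + Q)
        = ∫⁻ y in s, P.rnDeriv Q y ∂(P + Q).withDensity fun y ↦ ENNReal.ofReal (1 - h y) :=
          (setLIntegral_withDensity_eq_setLIntegral_mul _ hh1 hr hs).symm
      _ = ∫⁻ y in s, P.rnDeriv Q y ∂Q := by rw [hQ]
      _ ≤ P s := h1
      _ = ∫⁻ y in s, ENNReal.ofReal (h y) ∂(P + Q) := by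
          conv_lhs => rw [← hP]
          rw [withDensity_apply _ hs]
  calc ∫⁻ y, min (P.rnDeriv Q y) (ENNReal.ofReal t) ∂Q
      = ∫⁻ y, min (P.rnDeriv Q y) (ENNReal.ofReal t)
          ∂(P + Q).withDensity fun y ↦ ENNReal.ofReal (1 - h y) := by rw [hQ]
    _ = ∫⁻ y, ENNReal.ofReal (1 - h y) * min (P.rnDeriv Q y) (ENNReal.ofReal t) ∂(P + Q) :=
        lintegral_withDensity_eq_lintegral_mul _ hh1 (hr.min measurable_const)
    _ ≤ _ := lintegral_mono_ae (by
        filter_upwards [hle] with y hy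
        rw [ENNReal.ofReal_min]
        refine le_min ((mul_le_mul_right (min_le_left _ _) _).trans hy) ?_
        rw [ENNReal.ofReal_mul ht, mul_comm]
        exact mul_le_mul_left (min_le_right _ _) _)

theorem lintegral_min_le_Fit {E : Set (X × Y)} {νX : Measure X} {νY : Measure Y}
    {π : Measure (X × Y)} (hπ : π ∈ Plans E νX) {h : Y → unitInterval} (hh : Measurable h)
    (hP : (π.map Prod.snd + νY).withDensity (fun y ↦ ENNReal.ofReal (h y)) = π.map Prod.snd)
    (hQ : (π.map Prod.snd + νY).withDensity (fun y ↦ ENNReal.ofReal (1 - h y)) = νY)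
    {t : ℝ} (ht : 0 ≤ t) :
    ∫⁻ y, ENNReal.ofReal (min (h y : ℝ) (t * (1 - h y))) ∂(π.map Prod.snd + νY)
      ≤ Fit E νX νY t := by
  obtain ⟨hfin, hE, hfst⟩ := hπ
  let g : Y → ℝ≥0∞ := fun y ↦ ENNReal.ofReal (min (h y : ℝ) (t * (1 - h y)) / h y)
  have hg : Measurable g := by fun_prop
  have hh0 : Measurable fun y ↦ ENNReal.ofReal (h y) := by fun_prop
  have hle : π.withDensity (fun p ↦ g p.2) ≤ π := by
    conv_rhs => rw [← withDensity_one (μ := π)]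
    refine withDensity_mono (.of_forall fun p ↦ ?_)
    exact ENNReal.ofReal_le_one.2 (div_le_one_of_le₀ (min_le_left _ _) (h p.2).2.1)
  have hsnd : (π.withDensity fun p ↦ g p.2).map Prod.snd = (π.map Prod.snd + νY).withDensity
      fun y ↦ ENNReal.ofReal (min (h y : ℝ) (t * (1 - h y))) := by
    rw [map_withDensity_comp π measurable_snd hg]
    conv_lhs => rw [← hP]
    rw [← withDensity_mul _ hh0 hg]
    congr 1
    ext y
    rw [Pi.mul_apply, ← ENNReal.ofReal_mul (h y).2.1]
    congr 1
    by_cases h0 : (h y : ℝ) = 0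
    · rw [h0, zero_mul, min_eq_left (by simpa using ht)]
    · exact mul_div_cancel₀ _ h0
  have hmem : π.withDensity (fun p ↦ g p.2) ∈ Feas E νX νY t := by
    refine ⟨isFiniteMeasure_of_le π hle, withDensity_absolutelyContinuous _ _ hE,
      hfst ▸ Measure.map_mono hle measurable_fst, ?_⟩
    rw [hsnd]
    conv_rhs => rw [← hQ]
    rw [← withDensity_smul _ (by fun_prop)]
    refine withDensity_mono (.of_forall fun y ↦ ?_)
    rw [Pi.smul_apply, smul_eq_mul, ← ENNReal.ofReal_mul ht]
    exact ENNReal.ofReal_le_ofReal (min_le_right _ _)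
  calc _ = ((π.withDensity fun p ↦ g p.2).map Prod.snd) Set.univ := by
        rw [hsnd, withDensity_apply _ .univ, Measure.restrict_univ]
    _ = (π.withDensity fun p ↦ g p.2) Set.univ := Measure.map_apply measurable_snd .univ
    _ ≤ Fit E νX νY t := le_iSup₂_of_le _ hmem le_rfl

/-- Data processing along a measurable map. -/
theorem Divergence.HasDPI.map_le {𝒟 : Divergence} (h𝒟 : 𝒟.HasDPI) {A B : Type}
    [MeasurableSpace A] [MeasurableSpace B] {h : A → B} (hh : Measurable h) (P Q : Measure A)
    [IsFiniteMeasure P] [IsFiniteMeasure Q] :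
    𝒟.D B (P.map h) (Q.map h) ≤ 𝒟.D A P Q := by
  have := h𝒟 A B (Kernel.deterministic h hh) P Q
  rwa [Measure.deterministic_comp_eq_map, Measure.deterministic_comp_eq_map] at this

/-- Blackwell comparison of dichotomies: a pair with larger truncated likelihood masses at every
level is closer in every divergence satisfying data processing. -/
theorem Divergence.HasDPI.le_of_lintegral_min_le {𝒟 : Divergence} (h𝒟 : 𝒟.HasDPI) {Z : Type}
    [MeasurableSpace Z] [StandardBorelSpace Z] {P P' Q : Measure Z} [IsFiniteMeasure P]
    [IsFiniteMeasure P'] [IsFiniteMeasure Q] (hQpos : Q Set.univ ≠ 0)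
    (hPP' : P' Set.univ = P Set.univ) {h h' : Z → unitInterval}
    (hh : Measurable h) (hh' : Measurable h')
    (hP : (P + Q).withDensity (fun y ↦ ENNReal.ofReal (h y)) = P)
    (hQ : (P + Q).withDensity (fun y ↦ ENNReal.ofReal (1 - h y)) = Q)
    (hP' : (P' + Q).withDensity (fun y ↦ ENNReal.ofReal (h' y)) = P')
    (hQ' : (P' + Q).withDensity (fun y ↦ ENNReal.ofReal (1 - h' y)) = Q)
    (hmin : ∀ t : ℝ, 0 < t →
      ∫⁻ y, ENNReal.ofReal (min (h y : ℝ) (t * (1 - h y))) ∂(P + Q)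
        ≤ ∫⁻ y, ENNReal.ofReal (min (h' y : ℝ) (t * (1 - h' y))) ∂(P' + Q)) :
    𝒟.D Z P' Q ≤ 𝒟.D Z P Q := by
  have : Nonempty Z := by
    by_contra hZ
    rw [not_nonempty_iff] at hZ
    exact hQpos (by simp [Measure.eq_zero_of_isEmpty Q])
  have hm1 : Measurable fun v : unitInterval ↦ ENNReal.ofReal v := by fun_prop
  have hm0 : Measurable fun v : unitInterval ↦ ENNReal.ofReal (1 - v) := by fun_prop
  have hmap {R : Measure Z} {k : Z → unitInterval} (hk : Measurable k)
      (hR : (R + Q).withDensity (fun y ↦ ENNReal.ofReal (k y)) = R)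
      (hRQ : (R + Q).withDensity (fun y ↦ ENNReal.ofReal (1 - k y)) = Q) :
      R.map k = ((R + Q).map k).withDensity (fun v ↦ ENNReal.ofReal v) ∧
        Q.map k = ((R + Q).map k).withDensity (fun v ↦ ENNReal.ofReal (1 - v)) := by
    rw [← map_withDensity_comp (R + Q) hk hm1, ← map_withDensity_comp (R + Q) hk hm0, hR, hRQ]
    exact ⟨rfl, rfl⟩
  have hmean {R : Measure Z} {k : Z → unitInterval} (hk : Measurable k)
      (hR : (R + Q).withDensity (fun y ↦ ENNReal.ofReal (k y)) = R) :
      ∫⁻ v, ENNReal.ofReal v ∂((R + Q).map k) = R Set.univ := by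
    rw [lintegral_map hm1 hk]
    conv_rhs => rw [← hR, withDensity_apply _ .univ, Measure.restrict_univ]
  obtain ⟨hPh, hQh⟩ := hmap hh hP hQ
  obtain ⟨hPh', hQh'⟩ := hmap hh' hP' hQ'
  obtain ⟨K, hK, hKbind⟩ := exists_kernel_of_lintegral_min_le
    (α := (P + Q).map h) (β := (P' + Q).map h')
    (by simp [Measure.map_apply hh' .univ, hQpos])
    (by rw [Measure.map_apply hh .univ, Measure.map_apply hh' .univ]; simp [hPP'])
    (by rw [hmean hh hP, hmean hh' hP', hPP'])
    (fun t ht ↦ by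
      rw [lintegral_map (by fun_prop) hh, lintegral_map (by fun_prop) hh']
      exact hmin t ht)
  obtain ⟨L, hL, hLbind⟩ := exists_kernel_recovering (P' + Q) hh'
  have hKP : (P.map h).bind K = P'.map h' := by
    rw [hPh, hPh']
    simpa using hKbind 0 1 fun v ↦ by simpa using v.2.1
  have hKQ : (Q.map h).bind K = Q.map h' := by
    rw [hQh, hQh']
    simpa [← sub_eq_add_neg] using hKbind 1 (-1) fun v ↦ by
      have := v.2.2
      linarith
  have hLP : (P'.map h').bind L = P' := by simpa only [hP'] using hLbind _ hm1
  have hLQ : (Q.map h').bind L = Q := by simpa only [hQ'] using hLbind _ hm0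
  calc 𝒟.D Z P' Q = 𝒟.D Z ((P'.map h').bind L) ((Q.map h').bind L) := by rw [hLP, hLQ]
    _ ≤ 𝒟.D unitInterval (P'.map h') (Q.map h') := h𝒟 _ _ L _ _
    _ = 𝒟.D unitInterval ((P.map h).bind K) ((Q.map h).bind K) := by rw [hKP, hKQ]
    _ ≤ 𝒟.D unitInterval (P.map h) (Q.map h) := h𝒟 _ _ K _ _
    _ ≤ 𝒟.D Z P Q := h𝒟.map_le hh P Q

theorem level_opt_maximin_universal_closest_one_sided
    [TopologicalSpace X] [PolishSpace X] [BorelSpace X]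
    [TopologicalSpace Y] [PolishSpace Y] [BorelSpace Y]
    (E : Set (X × Y)) (hE : IsClosed E)
    (νX : Measure X) (νY : Measure Y) [IsFiniteMeasure νX] [IsFiniteMeasure νY]
    (hνX : 0 < νX Set.univ) (hνY : 0 < νY Set.univ)
    (hNbhdX : ∀ x : X, ∃ y : Y, (x, y) ∈ E) (hNbhdY : ∀ y : Y, ∃ x : X, (x, y) ∈ E)
    (πs : Measure (X × Y)) (hπs : πs ∈ Plans E νX)
    (hlom : LevelOptMaximin E νX νY πs) :
    ∀ 𝒟 : Divergence, 𝒟.HasDPI →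
      𝒟.D Y (πs.map Prod.snd) νY
        = sInf {d : EReal | ∃ π ∈ Plans E νX, d = 𝒟.D Y (π.map Prod.snd) νY} := by
  intro 𝒟 h𝒟
  refine le_antisymm (le_sInf ?_) (sInf_le ⟨πs, hπs, rfl⟩)
  rintro _ ⟨π, hπ, rfl⟩
  have : IsFiniteMeasure π := hπ.1
  have : IsFiniteMeasure πs := hπs.1
  have hmass (π' : Measure (X × Y)) (hπ' : π' ∈ Plans E νX) :
      (π'.map Prod.snd) Set.univ = νX Set.univ := by
    rw [← hπ'.2.2, Measure.map_apply measurable_snd .univ, Measure.map_apply measurable_fst .univ,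
      Set.preimage_univ, Set.preimage_univ]
  obtain ⟨h, hh, hP, hQ⟩ := exists_unitInterval_density (π.map Prod.snd) νY
  obtain ⟨h', hh', hP', hQ'⟩ := exists_unitInterval_density (πs.map Prod.snd) νY
  refine h𝒟.le_of_lintegral_min_le hνY.ne' (by rw [hmass π hπ, hmass πs hπs]) hh hh' hP hQ hP' hQ'
    fun t ht ↦ ?_
  calc _ ≤ Fit E νX νY t := lintegral_min_le_Fit hπ hh hP hQ ht.le
    _ = _ := (hlom t ht).symm
    _ ≤ _ := lintegral_min_rnDeriv_le hh' hP' hQ' ht.le
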